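/- arXiv:2404.03933 — 3 statements merged into one kernel-verified Lean document; each statement's English description precedes it below -/
import Mathlib

section
/- Let l ≥ 3 be an odd integer and q = e^{iπ/l} ∈ ℂ. For every integer p ≥ 0, the limit as v → q (over v ∈ ℂ outside the finite set {0} ∪ {v : v^{2s} = 1 for some 1 ≤ s ≤ lp}) of the rational function v ↦ ( ∏_{s=1}^{lp} (v^{s} − v^{−s}) ) / ( ∏_{s=1}^{l} (v^{s} − v^{−s}) )^{p} exists and equals (−1)^{p(p−1)/2} · p!. (This is the specialization at v = q of the quotient of quantum factorials [lp]!/([l]!)^{p}.) -/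
open Filter

/-- The set `Z_r = {0} ∪ {v : v^{2s} = 1 for some 1 ≤ s ≤ r}`. -/
def badSet (r : ℕ) : Set ℂ :=
  {0} ∪ {v : ℂ | ∃ s : ℕ, 1 ≤ s ∧ s ≤ r ∧ v ^ (2 * s) = 1}

/-- The rational function `v ↦ (∏_{s=1}^{lp} (v^s − v^{−s})) / (∏_{s=1}^{l} (v^s − v^{−s}))^p`,
i.e. the specialization of `[lp]!/([l]!)^p`. -/
noncomputable def qfacQuot (l p : ℕ) (v : ℂ) : ℂ :=
  (∏ i ∈ Finset.range (l * p), (v ^ ((i : ℤ) + 1) - v ^ (-((i : ℤ) + 1)))) /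
    (∏ i ∈ Finset.range l, (v ^ ((i : ℤ) + 1) - v ^ (-((i : ℤ) + 1)))) ^ p

noncomputable def ff (n : ℕ) (v : ℂ) : ℂ := v ^ ((n : ℤ) + 1) - v ^ (-((n : ℤ) + 1))

lemma ff_deriv (n : ℕ) (q : ℂ) (hq : q ≠ 0) :
    HasDerivAt (ff n) (((n : ℂ) + 1) * (q ^ ((n : ℤ) + 1) + q ^ (-((n : ℤ) + 1))) / q) q := by
  have h1 := hasDerivAt_zpow ((n : ℤ) + 1) q (Or.inl hq)
  have h2 := hasDerivAt_zpow (-((n : ℤ) + 1)) q (Or.inl hq)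
  refine (h1.sub h2).congr_deriv ?_
  rw [zpow_sub_one₀ hq, zpow_sub_one₀ hq]
  push_cast
  field_simp
  ring

lemma ff_shift (l k i : ℕ) (q : ℂ) (hq : q ≠ 0) (hl : q ^ l = -1) :
    q ^ (((l * k + i : ℕ) : ℤ) + 1) = (-1) ^ k * q ^ ((i : ℤ) + 1) ∧
    q ^ (-(((l * k + i : ℕ) : ℤ) + 1)) = (-1) ^ k * q ^ (-((i : ℤ) + 1)) := by
  have h : q ^ (((l * k + i : ℕ) : ℤ) + 1) = (-1) ^ k * q ^ ((i : ℤ) + 1) := by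
    rw [← hl, ← pow_mul]
    norm_cast
    rw [← pow_add, add_assoc]
  refine ⟨h, ?_⟩
  rw [zpow_neg, h, mul_inv, zpow_neg, ← inv_pow]
  norm_num

lemma ratio_tendsto (l k i : ℕ) (hi : i < l) (q : ℂ) (hq : q ≠ 0) (hl : q ^ l = -1)
    (hne : ∀ j, j + 1 < l → q ^ (2 * (j + 1)) ≠ 1) :
    Tendsto (fun v => ff (l * k + i) v / ff i v) (nhdsWithin q {q}ᶜ)
      (nhds ((-1) ^ k * (if i = l - 1 then ((k : ℂ) + 1) else 1))) := by
  obtain ⟨s1, s2⟩ := ff_shift l k i q hq hl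
  have d1 := ff_deriv (l * k + i) q hq
  have d2 := ff_deriv i q hq
  split_ifs with h
  · have hil : i + 1 = l := by omega
    have e1 : q ^ ((i : ℤ) + 1) = -1 := by
      rw [← hl, ← hil]; norm_cast
    have e2 : q ^ (-((i : ℤ) + 1)) = -1 := by
      rw [zpow_neg, e1]; norm_num
    have z2 : ff i q = 0 := by simp only [ff, e1, e2]; ring
    have z1 : ff (l * k + i) q = 0 := by
      simp only [ff, s1, s2, e1, e2]; ring
    have t := (hasDerivAt_iff_tendsto_slope.1 d1).div (hasDerivAt_iff_tendsto_slope.1 d2) ?_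
    · rw [s1, s2, e1, e2] at t
      have hi0 : (i : ℂ) + 1 ≠ 0 := by exact_mod_cast Nat.succ_ne_zero i
      have hlc : (l : ℂ) = i + 1 := by rw [← hil]; push_cast; ring
      convert t.congr' ?_ using 2
      · push_cast
        rw [hlc]
        field_simp
        ring
      · filter_upwards [self_mem_nhdsWithin] with v hv
        have hv' : v - q ≠ 0 := sub_ne_zero.2 hv
        simp only [Pi.div_apply, slope, vsub_eq_sub, z1, z2, sub_zero, smul_eq_mul]
        rw [mul_div_mul_left _ _ (inv_ne_zero hv')]
    · rw [e1, e2]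
      have hi0 : (i : ℂ) + 1 ≠ 0 := by exact_mod_cast Nat.succ_ne_zero i
      refine div_ne_zero (mul_ne_zero hi0 (by norm_num)) hq
  · have hz : ff i q ≠ 0 := by
      intro h0
      apply hne i (by omega)
      have h1 : q ^ ((i : ℤ) + 1) = q ^ (-((i : ℤ) + 1)) := sub_eq_zero.1 h0
      rw [zpow_neg] at h1
      norm_cast at h1
      rw [two_mul, pow_add]
      nth_rw 1 [h1]
      exact inv_mul_cancel₀ (pow_ne_zero _ hq)
    have t := (d1.continuousAt.tendsto.div d2.continuousAt.tendsto hz).mono_left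
      (nhdsWithin_le_nhds (s := {q}ᶜ))
    have e : (-1) ^ k * 1 = ff (l * k + i) q / ff i q := by
      rw [mul_one, eq_div_iff hz]
      simp only [ff, s1, s2]; ring
    rw [e]
    exact t

lemma quot_succ (l p : ℕ) (v : ℂ) : qfacQuot l (p + 1) v =
    qfacQuot l p v * ∏ i ∈ Finset.range l, (ff (l * p + i) v / ff i v) := by
  have e : ∀ l p, qfacQuot l p v =
    (∏ i ∈ Finset.range (l * p), ff i v) / (∏ i ∈ Finset.range l, ff i v) ^ p := fun _ _ => rfl
  rw [e, e, Finset.prod_div_distrib, mul_add_one, Finset.prod_range_add, pow_succ, div_mul_div_comm]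

lemma main_aux (l : ℕ) (hl : Odd l) (q : ℂ) (hq : q ≠ 0) (hql : q ^ l = -1)
    (hne : ∀ j, j + 1 < l → q ^ (2 * (j + 1)) ≠ 1) (p : ℕ) :
    Tendsto (qfacQuot l p) (nhdsWithin q {q}ᶜ)
      (nhds ((-1 : ℂ) ^ (p * (p - 1) / 2) * (p.factorial : ℂ))) := by
  induction p with
  | zero =>
    have : qfacQuot l 0 = fun _ => 1 := by ext v; simp [qfacQuot]
    rw [this]; simp
  | succ p ih =>
    have t := ih.mul (tendsto_finsetProd (Finset.range l) fun i hi =>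
      ratio_tendsto l p i (Finset.mem_range.1 hi) q hq hql hne)
    rw [show qfacQuot l (p + 1) = _ from funext (quot_succ l p)]
    convert t using 2
    have hl0 : l - 1 < l := by have := hl.pos; omega
    rw [Finset.prod_mul_distrib, Finset.prod_ite_eq']
    simp only [Finset.prod_const, Finset.card_range, Finset.mem_range, hl0, if_true]
    have h1 : (p + 1) * (p + 1 - 1) / 2 = p * (p - 1) / 2 + p := by
      rw [← Finset.sum_range_id_mul_two, ← Finset.sum_range_id_mul_two]
      simp [Finset.sum_range_succ]
    rw [h1, pow_add, ← pow_mul, mul_comm p l, pow_mul, hl.neg_one_pow, Nat.factorial_succ]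
    push_cast
    ring

theorem stmt2 (l : ℕ) (hl : Odd l) (hl3 : 3 ≤ l) (p : ℕ) :
    Tendsto (qfacQuot l p)
      (nhdsWithin (Complex.exp (Real.pi * Complex.I / l)) (badSet (l * p))ᶜ)
      (nhds ((-1 : ℂ) ^ (p * (p - 1) / 2) * (p.factorial : ℂ))) := by
  have hl0 : (l : ℂ) ≠ 0 := by exact_mod_cast (by omega : l ≠ 0)
  set q := Complex.exp (Real.pi * Complex.I / l) with hqdef
  have hql : q ^ l = -1 := by
    rw [hqdef, ← Complex.exp_nat_mul, mul_div_cancel₀ _ hl0, Complex.exp_pi_mul_I]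
  have hprim : IsPrimitiveRoot (q ^ 2) l := by
    have := Complex.isPrimitiveRoot_exp l (by omega)
    convert this using 1
    rw [hqdef, ← Complex.exp_nat_mul]
    congr 1
    push_cast
    ring
  have hne : ∀ j, j + 1 < l → q ^ (2 * (j + 1)) ≠ 1 := by
    intro j hj
    rw [pow_mul]
    exact hprim.pow_ne_one_of_pos_of_lt (by omega) hj
  rcases Nat.eq_zero_or_pos p with rfl | hp
  · have : qfacQuot l 0 = fun _ => 1 := by ext v; simp [qfacQuot]
    rw [this]; simpa using tendsto_const_nhds
  · refine (main_aux l hl q (Complex.exp_ne_zero _) hql hne p).mono_left (nhdsWithin_mono _ ?_)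
    intro v hv hvq
    apply hv
    right
    refine ⟨l, by omega, Nat.le_mul_of_pos_right l hp, ?_⟩
    rw [Set.mem_singleton_iff.1 hvq, mul_comm, pow_mul, hql]
    norm_num
end

section
/- Let l ≥ 3 be an odd integer and N ∈ ℕ. Then 2^{N} = Σ_{k=0}^{N} M^{(l)}_k(N) · d(k), where for k = k₁l + k₀ (with k₀ = k mod l) the dimension is d(k) := k₀+1 if k₁ = 0, d(k) := l(k₁+1) if k₁ ≥ 1 and k₀ = l−1, and d(k) := 2k₁l if k₁ ≥ 1 and 0 ≤ k₀ ≤ l−2. -/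
/-- `intBinom N j = binom(N, j)` for an integer `j`, with the convention that it vanishes
for `j < 0` or `j > N`. -/
def intBinom (N : ℕ) (j : ℤ) : ℤ :=
  if 0 ≤ j ∧ j ≤ (N : ℤ) then (N.choose j.toNat : ℤ) else 0

/-- `Fcoef N k = F^{(N)}_k = binom(N,(N−k)/2) − binom(N,(N−k−2)/2)` if `k ≡ N (mod 2)`,
and `0` otherwise. -/
def Fcoef (N : ℕ) (k : ℤ) : ℤ :=
  if ((N : ℤ) - k) % 2 = 0 then
    intBinom N (((N : ℤ) - k) / 2) - intBinom N (((N : ℤ) - k - 2) / 2)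
  else 0

/-- The multiplicity `M^{(l)}_k(N)` of the tilting module `T(k)` in `T(1)^{⊗N}`.
Writing `k = k₁ l + k₀` with `0 ≤ k₀ ≤ l−1`, it is `F^{(N)}_k` when `k₀ = l−1`, and
`Σ_{j≥0} (F^{(N)}_{k+2jl} − F^{(N)}_{(k₁+2j+2)l−k₀−2})` when `0 ≤ k₀ ≤ l−2`; all terms of the
infinite sum with `j > N` vanish, so it is truncated at `j = N`. -/
def Mmult (l k N : ℕ) : ℤ :=
  if k % l = l - 1 then Fcoef N k
  else ∑ j ∈ Finset.range (N + 1),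
    (Fcoef N ((k : ℤ) + 2 * j * l) -
      Fcoef N ((((k / l : ℕ) : ℤ) + 2 * (j : ℤ) + 2) * l - ((k % l : ℕ) : ℤ) - 2))

/-- The dimension `d(k)` of the indecomposable tilting module `T(k)`,
where `k = k₁ l + k₀` with `0 ≤ k₀ ≤ l−1`: it is `k₀+1` if `k₁ = 0`, `l(k₁+1)` if `k₁ ≥ 1` and
`k₀ = l−1`, and `2k₁l` if `k₁ ≥ 1` and `0 ≤ k₀ ≤ l−2`. -/
def dimT (l k : ℕ) : ℤ :=
  if k / l = 0 then ((k % l : ℕ) : ℤ) + 1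
  else if k % l = l - 1 then (l : ℤ) * (((k / l : ℕ) : ℤ) + 1)
  else 2 * ((k / l : ℕ) : ℤ) * l

lemma ib_eq (N : ℕ) (j : ℤ) : intBinom N j = if 0 ≤ j then (N.choose j.toNat : ℤ) else 0 := by
  unfold intBinom
  by_cases h : 0 ≤ j
  · by_cases h2 : j ≤ N
    · simp [h, h2]
    · have : N.choose j.toNat = 0 := Nat.choose_eq_zero_of_lt (by omega)
      simp [h2, this]
  · simp [h]

lemma ib_pascal (N : ℕ) (j : ℤ) : intBinom (N+1) j = intBinom N j + intBinom N (j-1) := by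
  simp only [ib_eq]
  rcases lt_trichotomy j 0 with h | h | h
  · rw [if_neg (by omega), if_neg (by omega), if_neg (by omega)]; rfl
  · subst h; simp
  · obtain ⟨n, rfl⟩ : ∃ n : ℕ, j = n + 1 := ⟨(j-1).toNat, by omega⟩
    rw [if_pos (by omega), if_pos (by omega), if_pos (by omega)]
    have h1 : ((n:ℤ)+1).toNat = n+1 := by omega
    have h2 : ((n:ℤ)+1-1).toNat = n := by omega
    rw [h1, h2, Nat.choose_succ_succ]; push_cast; ring

lemma F_rec (N : ℕ) (k : ℤ) : Fcoef (N+1) k = Fcoef N (k-1) + Fcoef N (k+1) := by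
  unfold Fcoef
  by_cases h : ((N:ℤ) + 1 - k) % 2 = 0
  · rw [if_pos (by push_cast; omega), if_pos (by omega), if_pos (by omega)]
    rw [ib_pascal, ib_pascal]
    have e1 : (((N+1:ℕ):ℤ) - k) / 2 = ((N:ℤ) - (k-1))/2 := by push_cast; omega
    have e2 : (((N+1:ℕ):ℤ) - k) / 2 - 1 = ((N:ℤ) - (k+1))/2 := by push_cast; omega
    have e3 : (((N+1:ℕ):ℤ) - k - 2) / 2 = ((N:ℤ) - (k-1) - 2)/2 := by push_cast; omega
    have e4 : (((N+1:ℕ):ℤ) - k - 2) / 2 - 1 = ((N:ℤ) - (k+1) - 2)/2 := by push_cast; omega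
    rw [e2, e1, e4, e3]; ring
  · rw [if_neg (by push_cast; omega), if_neg (by omega), if_neg (by omega)]; rfl

lemma F_big (N : ℕ) (k : ℤ) (h : (N:ℤ) < k) : Fcoef N k = 0 := by
  unfold Fcoef
  split_ifs
  · rw [ib_eq, ib_eq, if_neg (by omega), if_neg (by omega)]; rfl
  · rfl

lemma F_neg (N : ℕ) : Fcoef N (-1) = 0 := by
  unfold Fcoef
  split_ifs with h
  · obtain ⟨m, rfl⟩ : ∃ m : ℕ, N = 2*m+1 := ⟨N/2, by omega⟩
    have e1 : (((2*m+1:ℕ):ℤ) - -1)/2 = ((m+1:ℕ):ℤ) := by push_cast; omega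
    have e2 : (((2*m+1:ℕ):ℤ) - -1 - 2)/2 = (m:ℤ) := by push_cast; omega
    rw [e1, e2, ib_eq, ib_eq, if_pos (by omega), if_pos (by omega), Int.toNat_natCast,
      Int.toNat_natCast, Nat.choose_symm_half]; ring
  · rfl

lemma sum_aux (G : ℤ → ℤ) (n : ℕ) :
    ∑ k ∈ Finset.range n, (G ((k:ℤ)-1) + G ((k:ℤ)+1)) * ((k:ℤ)+1)
      = 2 * ∑ k ∈ Finset.range n, G (k:ℤ) * ((k:ℤ)+1) + G (-1) + n * G n - (n+1) * G ((n:ℤ)-1) := by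
  induction n with
  | zero => simp
  | succ n ih =>
    rw [Finset.sum_range_succ, Finset.sum_range_succ, ih]
    push_cast
    rw [show (n:ℤ)+1-1 = n by ring]
    ring

lemma sum_F (N : ℕ) : ∑ k ∈ Finset.range (N+1), Fcoef N (k:ℤ) * ((k:ℤ)+1) = 2^N := by
  induction N with
  | zero => simp [Fcoef, intBinom]
  | succ N ih =>
    simp only [F_rec]
    rw [sum_aux, F_neg, Finset.sum_range_succ, ih, F_big N ((N+1+1 : ℕ):ℤ) (by push_cast; omega),
      F_big N ((N+1:ℕ):ℤ) (by push_cast; omega),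
      F_big N (((N+1+1:ℕ):ℤ)-1) (by push_cast; omega)]
    ring

/-- reflection upwards -/
def upR (l k : ℕ) : ℕ := (k / l + 1) * l + (l - 2 - k % l)
/-- reflection downwards -/
def dnR (l k : ℕ) : ℕ := (k / l - 1) * l + (l - 2 - k % l)

lemma divmod_aux (l a b : ℕ) (hb : b < l) : (a * l + b) / l = a ∧ (a * l + b) % l = b := by
  constructor
  · rw [mul_comm, Nat.mul_add_div (by omega), Nat.div_eq_of_lt hb, add_zero]
  · rw [mul_comm, Nat.mul_add_mod, Nat.mod_eq_of_lt hb]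

lemma M_big (l k N : ℕ) (hl3 : 3 ≤ l) (h : N < k) : Mmult l k N = 0 := by
  unfold Mmult
  split_ifs with h0
  · exact F_big _ _ (by omega)
  · apply Finset.sum_eq_zero
    intro j _
    have h1 := Nat.div_add_mod k l
    have h2 := Nat.mod_lt k (show l > 0 by omega)
    generalize k / l = a at *
    generalize k % l = b at *
    have hjl : (0:ℤ) ≤ (j:ℤ) * l := by positivity
    zify at h1 h h2 hl3
    rw [F_big _ _ (by nlinarith), F_big _ _ ?_]; · rfl
    have : ((a:ℤ)+2*j+2)*l = l * a + 2*(j*l) + 2*l := by ring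
    rw [this]
    omega

lemma F_eq (l k N : ℕ) (hl3 : 3 ≤ l) (h : k % l ≠ l - 1) :
    Fcoef N k = Mmult l k N + Mmult l (upR l k) N := by
  have h1 := Nat.div_add_mod k l
  have h2 := Nat.mod_lt k (show l > 0 by omega)
  obtain ⟨e1, e2⟩ := divmod_aux l (k/l+1) (l-2-k%l) (by omega)
  unfold Mmult upR
  rw [e1, e2, if_neg h, if_neg (by omega), ← Finset.sum_add_distrib]
  generalize k / l = a at *
  generalize k % l = b at *
  have hc : ((l - 2 - b : ℕ):ℤ) = l - 2 - b := by omega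
  have key : ∀ j : ℕ, (Fcoef N ((k : ℤ) + 2 * j * l) -
      Fcoef N (((a : ℤ) + 2 * (j : ℤ) + 2) * l - (b : ℤ) - 2)) +
      (Fcoef N ((((a+1) * l + (l-2-b) : ℕ) : ℤ) + 2 * j * l) -
      Fcoef N ((((a+1 : ℕ) : ℤ) + 2 * (j : ℤ) + 2) * l - ((l-2-b : ℕ) : ℤ) - 2))
      = Fcoef N ((k : ℤ) + 2 * j * l) - Fcoef N ((k : ℤ) + 2 * (j+1 : ℕ) * l) := by
    intro j
    have h1' : (k:ℤ) = l * a + b := by exact_mod_cast h1.symm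
    have i1 : (((a+1) * l + (l-2-b) : ℕ) : ℤ) + 2 * j * l = ((a : ℤ) + 2 * (j : ℤ) + 2) * l - (b : ℤ) - 2 := by
      push_cast [hc]; ring
    have i2 : (((a+1 : ℕ) : ℤ) + 2 * (j : ℤ) + 2) * l - ((l-2-b : ℕ) : ℤ) - 2 = (k : ℤ) + 2 * (j+1 : ℕ) * l := by
      rw [hc, h1']; push_cast; ring
    rw [i1, i2]; ring
  rw [Finset.sum_congr rfl (fun j _ => key j),
    Finset.sum_range_sub' (fun j : ℕ => Fcoef N ((k : ℤ) + 2 * j * l)),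
    F_big N ((k : ℤ) + 2 * (N+1 : ℕ) * l) (by zify at hl3; push_cast; nlinarith)]
  simp

lemma dim_eq (l k : ℕ) (hl3 : 3 ≤ l) :
    dimT l k = ((k:ℤ)+1) + (if k % l ≠ l - 1 ∧ k / l ≠ 0 then ((dnR l k : ℕ):ℤ) + 1 else 0) := by
  have h1 := Nat.div_add_mod k l
  have h2 := Nat.mod_lt k (show l > 0 by omega)
  unfold dimT dnR
  generalize k / l = a at *
  generalize k % l = b at *
  have h1' : (k:ℤ) = l * a + b := by exact_mod_cast h1.symm
  rw [h1']
  by_cases ha : a = 0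
  · subst ha; simp
  · by_cases hb : b = l - 1
    · have : (b:ℤ) = l - 1 := by omega
      simp only [ha, hb]; simp; rw [← hb, this]; ring
    · have hc : ((l - 2 - b : ℕ):ℤ) = l - 2 - b := by omega
      have hd : ((a - 1 : ℕ):ℤ) = a - 1 := by omega
      rw [if_neg ha, if_neg hb, if_pos ⟨hb, ha⟩]
      push_cast [hc, hd]; ring

lemma up_props (l k : ℕ) (hl3 : 3 ≤ l) (h : k % l ≠ l - 1) :
    upR l k % l ≠ l - 1 ∧ upR l k / l ≠ 0 ∧ dnR l (upR l k) = k := by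
  have h1 := Nat.div_add_mod k l
  have h2 := Nat.mod_lt k (show l > 0 by omega)
  obtain ⟨e1, e2⟩ := divmod_aux l (k/l+1) (l-2-k%l) (by omega)
  refine ⟨?_, ?_, ?_⟩
  · unfold upR; rw [e2]; have : l - 2 - k % l ≤ l - 2 := Nat.sub_le _ _; omega
  · unfold upR; rw [e1]; exact Nat.succ_ne_zero _
  · unfold dnR upR; rw [e1, e2]
    have : l - 2 - (l - 2 - k % l) = k % l := by omega
    rw [this, Nat.add_sub_cancel, mul_comm]; exact h1

lemma dn_props (l k : ℕ) (hl3 : 3 ≤ l) (h : k % l ≠ l - 1) (h0 : k / l ≠ 0) :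
    dnR l k % l ≠ l - 1 ∧ dnR l k ≤ k ∧ upR l (dnR l k) = k := by
  have h1 := Nat.div_add_mod k l
  have h2 := Nat.mod_lt k (show l > 0 by omega)
  obtain ⟨e1, e2⟩ := divmod_aux l (k/l-1) (l-2-k%l) (by omega)
  obtain ⟨a, ha⟩ := Nat.exists_eq_succ_of_ne_zero h0
  refine ⟨?_, ?_, ?_⟩
  · unfold dnR; rw [e2]; have : l - 2 - k % l ≤ l - 2 := Nat.sub_le _ _; omega
  · unfold dnR; rw [ha] at h1 ⊢
    have : l * a.succ = a * l + l := by rw [Nat.succ_eq_add_one]; ring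
    rw [Nat.succ_sub_one]; omega
  · unfold upR dnR; rw [e1, e2]
    have : l - 2 - (l - 2 - k % l) = k % l := by omega
    rw [this, Nat.sub_add_cancel (by omega), mul_comm]; exact h1

theorem stmt6 (l : ℕ) (hl : Odd l) (hl3 : 3 ≤ l) (N : ℕ) :
    (2 : ℤ) ^ N = ∑ k ∈ Finset.range (N + 1), Mmult l k N * dimT l k := by
  have hF : ∀ k : ℕ, Fcoef N k * ((k:ℤ)+1) = Mmult l k N * ((k:ℤ)+1) +
      (if k % l ≠ l - 1 then Mmult l (upR l k) N * ((k:ℤ)+1) else 0) := by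
    intro k
    by_cases h : k % l = l - 1
    · simp [h, Mmult]
    · rw [if_pos h, F_eq l k N hl3 h]; ring
  have hD : ∀ k : ℕ, Mmult l k N * dimT l k = Mmult l k N * ((k:ℤ)+1) +
      (if k % l ≠ l - 1 ∧ k / l ≠ 0 then Mmult l k N * (((dnR l k : ℕ):ℤ)+1) else 0) := by
    intro k
    rw [dim_eq l k hl3]
    split_ifs <;> ring
  rw [← sum_F, Finset.sum_congr rfl (fun k _ => hF k), Finset.sum_congr rfl (fun k _ => hD k),
    Finset.sum_add_distrib, Finset.sum_add_distrib]
  congr 1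
  rw [← Finset.sum_filter, ← Finset.sum_filter]
  symm
  apply Finset.sum_bij_ne_zero (fun k _ _ => dnR l k)
  · intro k hk _
    simp only [Finset.mem_filter, Finset.mem_range] at hk ⊢
    obtain ⟨p1, p2, p3⟩ := dn_props l k hl3 hk.2.1 hk.2.2
    exact ⟨by omega, p1⟩
  · intro k hk _ k' hk' _ e
    simp only [Finset.mem_filter, Finset.mem_range] at hk hk'
    obtain ⟨p1, p2, p3⟩ := dn_props l k hl3 hk.2.1 hk.2.2
    obtain ⟨q1, q2, q3⟩ := dn_props l k' hl3 hk'.2.1 hk'.2.2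
    rw [← p3, ← q3, e]
  · intro k hk hne
    simp only [Finset.mem_filter, Finset.mem_range] at hk
    obtain ⟨p1, p2, p3⟩ := up_props l k hl3 hk.2
    have hN : upR l k ≤ N := by
      by_contra hc
      exact hne (by rw [M_big l _ N hl3 (by omega)]; ring)
    refine ⟨upR l k, ?_, ?_, p3⟩
    · simp only [Finset.mem_filter, Finset.mem_range]
      exact ⟨by omega, p1, p2⟩
    · rw [p3]; exact hne
  · intro k hk _
    simp only [Finset.mem_filter, Finset.mem_range] at hk
    obtain ⟨p1, p2, p3⟩ := dn_props l k hl3 hk.2.1 hk.2.2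
    rw [p3]
end

section
/- Let l ≥ 3 be an odd integer, N ∈ ℕ, and k₀ ∈ {0, …, l−2}. Then Σ_{j ∈ ℤ, j odd} Σ_{s=(|j|−1)/2}^{∞} M^{(l)}_{2l + k₀ + 2sl}(N) = Σ_{m=1}^{∞} (m² + m) F^{(N)}_{k₀ − 2(m+1)l} + Σ_{m=0}^{∞} ((m+1)² + (m+1)) F^{(N)}_{k₀ + 2(m+1)l}. (All sums have only finitely many nonzero terms; some of the numbers F^{(N)}_{k₀−2(m+1)l} may be negative.) -/
theorem intBinom_symm (N : ℕ) (j : ℤ) : intBinom N ((N : ℤ) - j) = intBinom N j := by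
  unfold intBinom
  by_cases h : 0 ≤ j ∧ j ≤ (N : ℤ)
  · rw [if_pos h, if_pos (by omega)]
    have : ((N : ℤ) - j).toNat = N - j.toNat := by omega
    rw [this, Nat.choose_symm (by omega)]
  · rw [if_neg h, if_neg (by omega)]

theorem Fcoef_anti (N : ℕ) (k : ℤ) : Fcoef N (-k - 2) = - Fcoef N k := by
  unfold Fcoef
  by_cases h : ((N : ℤ) - k) % 2 = 0
  · rw [if_pos h, if_pos (by omega), ← intBinom_symm N (((N : ℤ) - k) / 2),
      ← intBinom_symm N (((N : ℤ) - k - 2) / 2)]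
    have h1 : ((N : ℤ) - (-k - 2)) / 2 = N - ((N : ℤ) - k - 2) / 2 := by omega
    have h2 : ((N : ℤ) - (-k - 2) - 2) / 2 = N - ((N : ℤ) - k) / 2 := by omega
    rw [h1, h2]; ring
  · rw [if_neg h, if_neg (by omega)]; rfl

theorem Fcoef_zero (N : ℕ) (k : ℤ) (h : (N : ℤ) < k) : Fcoef N k = 0 := by
  unfold Fcoef intBinom
  split_ifs <;> first | rfl | omega

theorem weight_swap (c f : ℕ → ℤ) (n : ℕ) :
    ∑ p ∈ Finset.range n, c p * ∑ s ∈ Finset.Ico p n, f s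
      = ∑ s ∈ Finset.range n, (∑ p ∈ Finset.range (s + 1), c p) * f s := by
  induction n with
  | zero => simp
  | succ n ih =>
    rw [Finset.sum_range_succ (n := n) (f := fun s => (∑ p ∈ Finset.range (s + 1), c p) * f s),
      ← ih, Finset.sum_mul, Finset.sum_range_succ, Finset.sum_range_succ, ← add_assoc,
      ← Finset.sum_add_distrib]
    congr 1
    · apply Finset.sum_congr rfl
      intro p hp
      rw [Finset.sum_Ico_succ_top (by have := Finset.mem_range.1 hp; omega)]
      ring
    · simp

theorem odd_sum (H : ℕ → ℤ) (N : ℕ) :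
    ∑ j ∈ (Finset.Icc (-(N : ℤ)) (N : ℤ)).filter (fun j => Odd j), H ((j.natAbs - 1) / 2)
      = 2 * ∑ p ∈ Finset.range ((N + 1) / 2), H p := by
  induction N with
  | zero => simp [Finset.sum_filter]
  | succ n ih =>
    have e : Finset.Icc (-((n + 1 : ℕ) : ℤ)) ((n + 1 : ℕ) : ℤ)
        = insert (-((n : ℤ) + 1)) (insert ((n : ℤ) + 1) (Finset.Icc (-(n : ℤ)) (n : ℤ))) := by
      ext x; simp only [Finset.mem_Icc, Finset.mem_insert]; push_cast; omega
    rw [Finset.sum_filter] at ih ⊢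
    rw [e, Finset.sum_insert (by simp only [Finset.mem_Icc, Finset.mem_insert]; omega),
      Finset.sum_insert (by simp only [Finset.mem_Icc]; omega), ih]
    have a1 : (-((n : ℤ) + 1)).natAbs = n + 1 := by omega
    have a2 : ((n : ℤ) + 1).natAbs = n + 1 := by omega
    rw [a1, a2]
    rcases Nat.even_or_odd' n with ⟨m, rfl | rfl⟩
    · have o1 : Odd (-(((2 * m : ℕ) : ℤ) + 1)) := ⟨-m - 1, by push_cast; ring⟩
      have o2 : Odd (((2 * m : ℕ) : ℤ) + 1) := ⟨m, by push_cast; ring⟩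
      rw [if_pos o1, if_pos o2]
      have b1 : (2 * m + 1) / 2 = m := by omega
      have b2 : (2 * m + 1 + 1) / 2 = m + 1 := by omega
      have b3 : (2 * m + 1 - 1) / 2 = m := by omega
      rw [b1, b2, b3, Finset.sum_range_succ]; ring
    · have o1 : ¬ Odd (-(((2 * m + 1 : ℕ) : ℤ) + 1)) := by
        rintro ⟨x, hx⟩; omega
      have o2 : ¬ Odd (((2 * m + 1 : ℕ) : ℤ) + 1) := by
        rintro ⟨x, hx⟩; omega
      rw [if_neg o1, if_neg o2]
      have b1 : (2 * m + 1 + 1) / 2 = m + 1 := by omega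
      have b2 : (2 * m + 1 + 1 + 1) / 2 = m + 1 := by omega
      rw [b1, b2]; ring

theorem Mmult_eq (l : ℕ) (hl3 : 3 ≤ l) (N k₀ : ℕ) (hk₀ : k₀ ≤ l - 2) (s : ℕ) :
    Mmult l (2 * l + k₀ + 2 * s * l) N = ∑ j ∈ Finset.range (N + 1),
      (Fcoef N ((k₀ : ℤ) + 2 * (((s + j : ℕ) : ℤ) + 1) * l)
        + Fcoef N ((k₀ : ℤ) - 2 * (((s + j : ℕ) : ℤ) + 2) * l)) := by
  have e : 2 * l + k₀ + 2 * s * l = k₀ + l * (2 * s + 2) := by ring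
  have hm : (2 * l + k₀ + 2 * s * l) % l = k₀ := by
    rw [e, Nat.add_mul_mod_self_left, Nat.mod_eq_of_lt (by omega)]
  have hd : (2 * l + k₀ + 2 * s * l) / l = 2 * s + 2 := by
    rw [e, Nat.add_mul_div_left _ _ (by omega), Nat.div_eq_of_lt (by omega), zero_add]
  unfold Mmult
  rw [hm, hd, if_neg (by omega)]
  apply Finset.sum_congr rfl
  intro j _
  rw [sub_eq_add_neg, ← Fcoef_anti]
  congr 2 <;> push_cast <;> ring

/-- All infinite sums in the statement have finitely many nonzero terms: `M^{(l)}_k(N) = 0`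
for `k > N` and `F^{(N)}_k = 0` for `k > N` or `k < −N−2`, so the sums over `j` (odd integers)
and over `s`, `m` are truncated at `|j| ≤ N`, `s ≤ N`, `m ≤ N` without changing their values. -/
theorem stmt8 (l : ℕ) (hl : Odd l) (hl3 : 3 ≤ l) (N k₀ : ℕ) (hk₀ : k₀ ≤ l - 2) :
    ∑ j ∈ (Finset.Icc (-(N : ℤ)) (N : ℤ)).filter (fun j => Odd j),
      ∑ s ∈ Finset.Icc ((j.natAbs - 1) / 2) N, Mmult l (2 * l + k₀ + 2 * s * l) N
    = ∑ m ∈ Finset.Icc 1 N, ((m : ℤ) ^ 2 + m) * Fcoef N ((k₀ : ℤ) - 2 * (m + 1) * l)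
      + ∑ m ∈ Finset.range (N + 1),
          (((m : ℤ) + 1) ^ 2 + ((m : ℤ) + 1)) * Fcoef N ((k₀ : ℤ) + 2 * (m + 1) * l) := by
  set g : ℕ → ℤ := fun t => Fcoef N ((k₀ : ℤ) + 2 * ((t : ℤ) + 1) * l)
        + Fcoef N ((k₀ : ℤ) - 2 * ((t : ℤ) + 2) * l) with hg
  have hk : (k₀ : ℤ) + 2 ≤ l := by omega
  have hl' : (3 : ℤ) ≤ l := by omega
  have ha : ∀ t : ℕ, N < 2 * (t + 1) → Fcoef N ((k₀ : ℤ) + 2 * ((t : ℤ) + 1) * l) = 0 := by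
    intro t ht
    apply Fcoef_zero
    have : (N : ℤ) < 2 * (t + 1) := by exact_mod_cast ht
    nlinarith
  have hb : ∀ t : ℕ, N < 2 * (t + 1) → Fcoef N ((k₀ : ℤ) - 2 * ((t : ℤ) + 2) * l) = 0 := by
    intro t ht
    have : (N : ℤ) < 2 * (t + 1) := by exact_mod_cast ht
    have h := Fcoef_anti N ((k₀ : ℤ) - 2 * ((t : ℤ) + 2) * l)
    rw [Fcoef_zero N _ (by nlinarith)] at h
    linarith
  have hg0 : ∀ t : ℕ, N < 2 * (t + 1) → g t = 0 := by
    intro t ht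
    simp only [hg, ha t ht, hb t ht, add_zero]
  have hM : ∀ s : ℕ, Mmult l (2 * l + k₀ + 2 * s * l) N = ∑ t ∈ Finset.Ico s (N + 1), g t := by
    intro s
    rw [Mmult_eq l hl3 N k₀ hk₀ s]
    have : ∑ t ∈ Finset.Ico s (N + 1), g t = ∑ t ∈ Finset.Ico s (s + (N + 1)), g t := by
      apply Finset.sum_subset
      · intro x; simp only [Finset.mem_Ico]; omega
      · intro x h1 h2
        simp only [Finset.mem_Ico] at h1 h2
        exact hg0 x (by omega)
    rw [this, Finset.sum_Ico_eq_sum_range]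
    simp [hg]
  have hH : ∀ p : ℕ, ∑ s ∈ Finset.Icc p N, Mmult l (2 * l + k₀ + 2 * s * l) N
      = ∑ s ∈ Finset.Ico p (N + 1), ∑ t ∈ Finset.Ico s (N + 1), g t := by
    intro p
    apply Finset.sum_congr
    · ext x; simp only [Finset.mem_Icc, Finset.mem_Ico]; omega
    · intro x _; exact hM x
  have hL := odd_sum (fun p => ∑ s ∈ Finset.Icc p N, Mmult l (2 * l + k₀ + 2 * s * l) N) N
  rw [hL]
  simp only [hH]
  have hext : ∑ p ∈ Finset.range ((N + 1) / 2),
      ∑ s ∈ Finset.Ico p (N + 1), ∑ t ∈ Finset.Ico s (N + 1), g t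
      = ∑ p ∈ Finset.range (N + 1),
      1 * ∑ s ∈ Finset.Ico p (N + 1), ∑ t ∈ Finset.Ico s (N + 1), g t := by
    simp only [one_mul]
    apply Finset.sum_subset
    · intro x; simp only [Finset.mem_range]; omega
    · intro x _ h2
      simp only [Finset.mem_range] at h2
      apply Finset.sum_eq_zero
      intro s hs
      apply Finset.sum_eq_zero
      intro t ht
      simp only [Finset.mem_Ico] at hs ht
      exact hg0 t (by omega)
  rw [hext, weight_swap (fun _ => 1), weight_swap]
  have hc : ∀ t : ℕ, 2 * ∑ p ∈ Finset.range (t + 1), ∑ _q ∈ Finset.range (p + 1), (1 : ℤ)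
      = ((t : ℤ) + 1) ^ 2 + ((t : ℤ) + 1) := by
    intro t
    induction t with
    | zero => simp
    | succ t ih =>
      rw [Finset.sum_range_succ, mul_add, ih]
      simp
      ring
  have hB : ∑ m ∈ Finset.Icc 1 N, ((m : ℤ) ^ 2 + m) * Fcoef N ((k₀ : ℤ) - 2 * (m + 1) * l)
      = ∑ t ∈ Finset.range (N + 1),
        (((t : ℤ) + 1) ^ 2 + ((t : ℤ) + 1)) * Fcoef N ((k₀ : ℤ) - 2 * ((t : ℤ) + 2) * l) := by
    rw [Finset.sum_range_succ, hb N (by omega), mul_zero, add_zero]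
    have : Finset.Icc 1 N = Finset.Ico 1 (N + 1) := by
      ext x; simp only [Finset.mem_Icc, Finset.mem_Ico]; omega
    rw [this, Finset.sum_Ico_eq_sum_range]
    apply Finset.sum_congr (by simp)
    intro t _
    have : (k₀ : ℤ) - 2 * (((1 + t : ℕ) : ℤ) + 1) * l = (k₀ : ℤ) - 2 * ((t : ℤ) + 2) * l := by
      push_cast; ring
    rw [this]
    push_cast; ring
  rw [hB, ← Finset.sum_add_distrib, Finset.mul_sum]
  apply Finset.sum_congr rfl
  intro t _
  rw [← mul_assoc, hc t]
  simp only [hg]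
  ring
end
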